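/- Let W = W_1^n be an upward primitive disk word with n > 2. Then n is even, x_2 = X with h(x_2) = 1, and x_{n-1} = X^{-1} with h(x_{n-1}) = 1. Dually, if W is a downward primitive disk word with n > 2, then n is even, x_2 = X^{-1} with h(x_2) = -1, and x_{n-1} = X with h(x_{n-1}) = -1. -/

import Mathlib

/-- A letter of the alphabet `{X, X⁻¹, Y, Y⁻¹}`. -/
inductive L where
  | X | Xi | Y | Yi
deriving DecidableEq

/-- A word is a finite sequence of letters. -/
abbrev Word := List L

/-- Whether a letter is an `X`-letter, i.e. `X` or `X⁻¹`. -/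
def L.isX : L → Bool
  | .X => true
  | .Xi => true
  | _ => false

/-- The sign of a letter: `+1` for `X`, `-1` for `X⁻¹`, `0` for `Y`-letters. -/
def L.sgn : L → ℤ
  | .X => 1
  | .Xi => -1
  | _ => 0

/-- The formal inverse of a letter. -/
def L.inv : L → L
  | .X => .Xi
  | .Xi => .X
  | .Y => .Yi
  | .Yi => .Y

/-- `phi W` = (number of `X`'s in `W`) - (number of `X⁻¹`'s in `W`). -/
def phi (w : Word) : ℤ := (w.map L.sgn).sum

/-- The subsequence of `X`-letters `x₁, …, xₙ` of a word. -/
def xLetters (w : Word) : Word := w.filter (·.isX)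

/-- The number `n` of `X`-letters of a word. -/
def numX (w : Word) : ℕ := (xLetters w).length

/-- The `i`-th `X`-letter `xᵢ` of a word (1-indexed; junk value `Y` out of range). -/
def xLtr (w : Word) (i : ℕ) : L := (xLetters w).getD (i - 1) L.Y

/-- `phi (W₁ⁱ)`: the sign-sum of the first `i` `X`-letters of `W`. -/
def phiPrefix (w : Word) (i : ℕ) : ℤ := (((xLetters w).take i).map L.sgn).sum

/-- `W` is a disk word: it has `n ≥ 2` `X`-letters, its first letter is `x₁`,
its last letter is `xₙ`, `x₁` and `xₙ` have opposite signs, and `phi W = 0`. -/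
def IsDiskWord (w : Word) : Prop :=
  2 ≤ numX w ∧
  w.head? = (xLetters w).head? ∧
  w.getLast? = (xLetters w).getLast? ∧
  phi w = 0 ∧
  (xLtr w 1).sgn = -(xLtr w (numX w)).sgn

/-- A disk word `W = W₁ⁿ` is primitive if `phi (W₁ᵏ) ≠ 0` for all `1 < k < n`. -/
def IsPrimitive (w : Word) : Prop :=
  IsDiskWord w ∧ ∀ k, 1 < k → k < numX w → phiPrefix w k ≠ 0

/-- A disk word is upward if `x₁ = X`. -/
def Upward (w : Word) : Prop := xLtr w 1 = L.X

/-- A disk word is downward if `x₁ = X⁻¹`. -/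
def Downward (w : Word) : Prop := xLtr w 1 = L.Xi

/-- `eps W i = 1` if `xᵢ` has the same sign as `x₁`, and `0` otherwise. -/
def eps (w : Word) (i : ℕ) : ℤ := if xLtr w i = xLtr w 1 then 1 else 0

/-- The height `h(xᵢ)`: `phi (W₁ⁱ) - eps xᵢ` in the upward case and
`phi (W₁ⁱ) + eps xᵢ` in the downward case. -/
def height (w : Word) (i : ℕ) : ℤ :=
  if xLtr w 1 = L.X then phiPrefix w i - eps w i else phiPrefix w i + eps w i

/-- A word is reduced if it has no adjacent pair of mutually inverse letters. -/
def Reduced (w : Word) : Prop := w.Chain' (fun a b => b ≠ a.inv)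

/-- The (0-indexed) positions in `w` of its `X`-letters. -/
def xPos (w : Word) : List ℕ :=
  (List.range w.length).filter (fun i => (w.getD i L.Y).isX)

/-- `subword w i j` = `Wᵢʲ`, the contiguous subword of `w` from the `i`-th
to the `j`-th `X`-letter (1-indexed, inclusive). -/
def subword (w : Word) (i j : ℕ) : Word :=
  (w.take ((xPos w).getD (j - 1) 0 + 1)).drop ((xPos w).getD (i - 1) 0)

/-- `Y^m`: `m` copies of `Y` if `m ≥ 0`, `-m` copies of `Y⁻¹` if `m < 0`. -/
def Ypow (m : ℤ) : Word :=
  if 0 ≤ m then List.replicate m.toNat L.Y else List.replicate (-m).toNat L.Yi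


theorem phi_eq_sum_xLetters (w : Word) : phi w = ((xLetters w).map L.sgn).sum := by
  unfold phi xLetters
  induction w with
  | nil => rfl
  | cons a t ih => cases a <;> simp [L.isX, L.sgn, ih]

theorem even_phi_sub_numX (w : Word) : Even (phi w - numX w) := by
  unfold phi numX xLetters
  induction w with
  | nil => simp
  | cons a t ih =>
    cases a <;> simp [L.isX, L.sgn] at ih ⊢ <;> grind

theorem phiPrefix_zero (w : Word) : phiPrefix w 0 = 0 := by simp [phiPrefix]

theorem phiPrefix_succ (w : Word) (k : ℕ) :
    phiPrefix w (k + 1) = phiPrefix w k + (xLtr w (k + 1)).sgn := by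
  unfold phiPrefix xLtr
  rw [List.take_add_one]
  by_cases h : k < (xLetters w).length
  · simp [h]
  · simp [h, L.sgn]

theorem phiPrefix_numX (w : Word) : phiPrefix w (numX w) = phi w := by
  rw [phi_eq_sum_xLetters, phiPrefix, numX, List.take_length]

theorem xLtr_eq_X_or_Xi {w : Word} {k : ℕ} (h : k < numX w) :
    xLtr w (k + 1) = L.X ∨ xLtr w (k + 1) = L.Xi := by
  have hm : xLtr w (k + 1) ∈ xLetters w := by
    rw [xLtr, Nat.add_sub_cancel, List.getD_eq_getElem _ _ h]
    exact List.getElem_mem h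
  have hX := (List.mem_filter.mp hm).2
  revert hX
  cases xLtr w (k + 1) <;> simp [L.isX]

/-- for a primitive disk word with `n > 2` `X`-letters, `n` is even and,
in the upward case, `x₂ = X`, `x_{n-1} = X⁻¹` both of height `1`; dually in the
downward case `x₂ = X⁻¹`, `x_{n-1} = X` both of height `-1`. -/
theorem second_and_secondlast_letters (w : Word) (hw : IsPrimitive w) (hn : 2 < numX w) :
    (Upward w → Even (numX w) ∧ xLtr w 2 = L.X ∧ height w 2 = 1 ∧
      xLtr w (numX w - 1) = L.Xi ∧ height w (numX w - 1) = 1) ∧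
    (Downward w → Even (numX w) ∧ xLtr w 2 = L.Xi ∧ height w 2 = -1 ∧
      xLtr w (numX w - 1) = L.X ∧ height w (numX w - 1) = -1) := by
  obtain ⟨⟨-, -, -, hphi, hsgn⟩, hprim⟩ := hw
  have heven : Even (numX w) := by
    have h := even_phi_sub_numX w
    rw [hphi] at h
    simpa using h
  obtain ⟨m, hm⟩ : ∃ m, numX w = m + 4 := by
    obtain ⟨r, hr⟩ := heven
    exact ⟨numX w - 4, by omega⟩
  have h1 := phiPrefix_succ w 0
  have h2 := phiPrefix_succ w 1
  have hpen := phiPrefix_succ w (m + 2)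
  have hlast := phiPrefix_succ w (m + 3)
  have htotal := phiPrefix_numX w
  have hne2 := hprim 2 (by omega) (by omega)
  have hnepen := hprim (m + 2) (by omega) (by omega)
  have hl2 := xLtr_eq_X_or_Xi (w := w) (k := 1) (by omega)
  have hlpen := xLtr_eq_X_or_Xi (w := w) (k := m + 2) (by omega)
  rw [phiPrefix_zero] at h1
  rw [hm] at htotal hsgn heven ⊢
  rw [show m + 4 - 1 = m + 3 by omega]
  norm_num [add_assoc] at h1 h2 hpen hlast hl2 hlpen
  constructor <;> intro hup <;> simp only [Upward, Downward] at hup <;>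
    rcases hl2 with hl2 | hl2 <;> rcases hlpen with hlpen | hlpen <;>
    simp only [height, eps, hup, hl2, hlpen, L.sgn] at * <;>
    refine ⟨heven, ?_⟩ <;> simp <;> omega
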